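/- For every m ≥ 1 the map φ_m : A^e ⊗ ∧^m(V) → A^{⊗(m+2)} is injective. -/

import Mathlib

set_option synthInstance.maxHeartbeats 1000000
set_option maxHeartbeats 1000000

noncomputable section

open scoped TensorProduct

section QSA
variable (k : Type) [Field k] (N : ℕ) (q : Fin N → Fin N → k)

/-- The commutation relations of the quantum symmetric algebra. -/
inductive QRel : FreeAlgebra k (Fin N) → FreeAlgebra k (Fin N) → Prop
  | rel (i j : Fin N) : QRel (FreeAlgebra.ι k i * FreeAlgebra.ι k j)
      (q i j • (FreeAlgebra.ι k j * FreeAlgebra.ι k i))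

/-- The quantum symmetric algebra `A = S_q(V)`. -/
abbrev QSA := RingQuot (QRel k N q)

/-- The generator `x_i` of `S_q(V)`. -/
def X (i : Fin N) : QSA k N q := RingQuot.mkAlgHom k (QRel k N q) (FreeAlgebra.ι k i)

/-- The product `x_{j_1} x_{j_2} ⋯ x_{j_m}` associated to a tuple `j : Fin m → Fin N`. -/
def xprod (m : ℕ) (j : Fin m → Fin N) : QSA k N q := (List.ofFn fun t => X k N q (j t)).prod

/-- The enveloping algebra `A^e = A ⊗_k A^{op}`. -/
abbrev QSAe := QSA k N q ⊗[k] (QSA k N q)ᵐᵒᵖ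

/-- The tower of tensor powers: `TP n` is `A^{⊗(n+1)}`, as a `k`-module. -/
def TP : ℕ → ModuleCat k
  | 0 => ModuleCat.of k (QSA k N q)
  | n + 1 => ModuleCat.of k (QSA k N q ⊗[k] TP n)

/-- An elementary tensor `v 0 ⊗ v 1 ⊗ ⋯ ⊗ v n` in `A^{⊗(n+1)}`. -/
def tp : (n : ℕ) → (Fin (n + 1) → QSA k N q) → TP k N q n
  | 0, v => v 0
  | n + 1, v => show QSA k N q ⊗[k] TP k N q n from (v 0) ⊗ₜ[k] tp n (fun t => v t.succ)

/-- Left multiplication by an element of `A` on the first tensor factor of `A^{⊗(n+1)}`. -/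
def lAct : (n : ℕ) → QSA k N q →ₗ[k] (TP k N q n →ₗ[k] TP k N q n)
  | 0 => LinearMap.mul k (QSA k N q)
  | n + 1 => (LinearMap.rTensorHom (TP k N q n)).comp (LinearMap.mul k (QSA k N q))

/-- Right multiplication by an element of `A` on the last tensor factor of `A^{⊗(n+1)}`. -/
def rAct : (n : ℕ) → QSA k N q →ₗ[k] (TP k N q n →ₗ[k] TP k N q n)
  | 0 => (LinearMap.mul k (QSA k N q)).flip
  | n + 1 =>
    show QSA k N q →ₗ[k]
        (QSA k N q ⊗[k] TP k N q n →ₗ[k] QSA k N q ⊗[k] TP k N q n) from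
      (LinearMap.lTensorHom (QSA k N q)).comp (rAct n)

/-- The outer `A^e = A ⊗ A^{op}`-action on `A^{⊗(n+1)}`: `a ⊗ b^{op}` acts by multiplying
by `a` on the left in the first factor and by `b` on the right in the last factor. -/
def outerAct (n : ℕ) : QSAe k N q →ₗ[k] (TP k N q n →ₗ[k] TP k N q n) :=
  TensorProduct.lift
    (LinearMap.mk₂ k
      (fun a b => (lAct k N q n a).comp (rAct k N q n (MulOpposite.unop b)))
      (fun a a' b => by simp [map_add, LinearMap.add_comp])
      (fun c a b => by simp [map_smul, LinearMap.smul_comp])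
      (fun a b b' => by simp [map_add, LinearMap.comp_add])
      (fun c a b => by simp [map_smul, LinearMap.comp_smul]))

end QSA

section Bar
variable (k : Type) [Field k] (N : ℕ) (q : Fin N → Fin N → k)

/-- Multiplication of the first two tensor factors: `A^{⊗(n+2)} → A^{⊗(n+1)}`. -/
def barMul₀ : (n : ℕ) → (TP k N q (n + 1) →ₗ[k] TP k N q n)
  | 0 => LinearMap.mul' k (QSA k N q)
  | n + 1 =>
    show QSA k N q ⊗[k] (QSA k N q ⊗[k] TP k N q n) →ₗ[k] QSA k N q ⊗[k] TP k N q n from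
      (LinearMap.rTensor (TP k N q n) (LinearMap.mul' k (QSA k N q))).comp
        (TensorProduct.assoc k (QSA k N q) (QSA k N q) (TP k N q n)).symm.toLinearMap

/-- Multiplication of the tensor factors in positions `i, i+1` of `A^{⊗(n+2)}`
(0-indexed; for `i > n` we set the map to be zero, which does not occur below). -/
def barFace : (n : ℕ) → (i : ℕ) → (TP k N q (n + 1) →ₗ[k] TP k N q n)
  | n, 0 => barMul₀ k N q n
  | 0, _ + 1 => 0
  | n + 1, i + 1 =>
    show QSA k N q ⊗[k] TP k N q (n + 1) →ₗ[k] QSA k N q ⊗[k] TP k N q n from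
      LinearMap.lTensor (QSA k N q) (barFace n i)

/-- The bar differential `δ_n : A^{⊗(n+2)} → A^{⊗(n+1)}`,
`δ_n(a_0 ⊗ ⋯ ⊗ a_{n+1}) = Σ_{i=0}^{n} (-1)^i a_0 ⊗ ⋯ ⊗ a_i a_{i+1} ⊗ ⋯ ⊗ a_{n+1}`. -/
def barD (n : ℕ) : TP k N q (n + 1) →ₗ[k] TP k N q n :=
  ∑ i ∈ Finset.range (n + 1), ((-1 : ℤ) ^ i) • barFace k N q n i

end Bar

section Phi
variable (k : Type) [Field k] (N : ℕ) (q : Fin N → Fin N → k)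

/-- `A` is a left `A^e`-module via left and right multiplication. -/
instance : Module (QSAe k N q) (QSA k N q) := TensorProduct.Algebra.module

/-- The `m`-th term `A^e ⊗ ∧^m(V)` of the Koszul complex, realised as the free
`A^e`-module on the set of `m`-element subsets of `{1,…,N}` (corresponding to the basis
`x_{j_1} ∧ ⋯ ∧ x_{j_m}`, `j_1 < ⋯ < j_m`, of `∧^m(V)`). -/
abbrev KM (m : ℕ) := {S : Finset (Fin N) // S.card = m} →₀ QSAe k N q

/-- The increasing enumeration `j_1 < j_2 < ⋯ < j_m` of an `m`-element subset of `{1,…,N}`. -/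
def jfun (m : ℕ) (S : {S : Finset (Fin N) // S.card = m}) : Fin m → Fin N :=
  fun t => S.1.orderIsoOfFin S.2 t

/-- The element `Σ_{π ∈ S_m} sgn(π) q_π^{j_1,…,j_m} ⊗ x_{j_{π(1)}} ⊗ ⋯ ⊗ x_{j_{π(m)}} ⊗ 1`
of `A^{⊗(m+2)}`, where `Qs` encodes the scalars `q_π^{j_1,…,j_m}`. -/
def phiElt (Qs : (m : ℕ) → (Fin m → Fin N) → Equiv.Perm (Fin m) → k) (m : ℕ)
    (S : {S : Finset (Fin N) // S.card = m}) : TP k N q (m + 1) :=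
  ∑ π : Equiv.Perm (Fin m),
    ((Equiv.Perm.sign π : ℤ) • Qs m (jfun N m S) π) •
      tp k N q (m + 1)
        (Fin.cons 1 (Fin.snoc (fun t : Fin m => X k N q (jfun N m S (π t))) 1))

/-- The chain map `φ_m : A^e ⊗ ∧^m(V) → A^{⊗(m+2)}` of the paper, determined by
`φ_m(1 ⊗ 1 ⊗ x_{j_1} ∧ ⋯ ∧ x_{j_m}) =
  Σ_{π ∈ S_m} sgn(π) q_π^{j_1,…,j_m} ⊗ x_{j_{π(1)}} ⊗ ⋯ ⊗ x_{j_{π(m)}} ⊗ 1`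
together with `A^e`-linearity (the outer two tensor factors carry the `A^e`-action). -/
def phi (Qs : (m : ℕ) → (Fin m → Fin N) → Equiv.Perm (Fin m) → k) (m : ℕ) :
    KM k N q m →ₗ[k] TP k N q (m + 1) :=
  Finsupp.lsum k fun S => (outerAct k N q (m + 1)).flip (phiElt k N q Qs m S)

/-- The Koszul differential `d_{m+1}`, as an `A^e`-linear map. -/
def kd (m : ℕ) : KM k N q (m + 1) →ₗ[QSAe k N q] KM k N q m :=
  Finsupp.linearCombination (QSAe k N q)
    (fun S : {S : Finset (Fin N) // S.card = m + 1} =>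
      ∑ i ∈ S.1.attach,
        ((-1 : k) ^ (S.1.filter (fun s => s < i.1)).card) •
          Finsupp.single
            (⟨S.1.erase i.1, by rw [Finset.card_erase_of_mem i.2, S.2]; rfl⟩ :
              {S : Finset (Fin N) // S.card = m})
            ((∏ s ∈ S.1.filter (fun s => s ≤ i.1), q s i.1) •
                (X k N q i.1 ⊗ₜ[k] (1 : (QSA k N q)ᵐᵒᵖ))
              - (∏ s ∈ S.1.filter (fun s => i.1 ≤ s), q i.1 s) •
                ((1 : QSA k N q) ⊗ₜ[k] MulOpposite.op (X k N q i.1))))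

/-- The Koszul differential, as a `k`-linear map. -/
def kdk (m : ℕ) : KM k N q (m + 1) →ₗ[k] KM k N q m :=
  LinearMap.restrictScalars k (kd k N q m)

end Phi

section Aux
variable (k : Type) [Field k] (N : ℕ) (q : Fin N → Fin N → k)

/-- The linear functional picking the coefficient of `x_i`. -/
def fHom (i : Fin N) : QSA k N q →ₐ[k] TrivSqZeroExt k k :=
  RingQuot.liftAlgHom k ⟨FreeAlgebra.lift k (fun j => TrivSqZeroExt.inr (if i = j then (1:k) else 0)), by
    rintro _ _ ⟨a, b⟩
    simp⟩

def fFun (i : Fin N) : QSA k N q →ₗ[k] k :=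
  (TrivSqZeroExt.sndHom k k).comp (fHom k N q i).toLinearMap

lemma fFun_X (i j : Fin N) : fFun k N q i (X k N q j) = if i = j then 1 else 0 := by
  by_cases h : i = j <;> simp [fFun, X, fHom, h]

def cc (j : Fin N) (a : Fin N → ℕ) : k := ∏ l, if l < j then q l j ^ a l else 1

lemma cc_add (i j : Fin N) (a : Fin N → ℕ) :
    cc k N q j (a + Pi.single i 1) = cc k N q j a * (if i < j then q i j else 1) := by
  unfold cc
  have : (if i < j then q i j else 1) = ∏ l, (if l = i then (if i < j then q i j else 1) else 1) := by
    simp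
  rw [this, ← Finset.prod_mul_distrib]
  refine Finset.prod_congr rfl fun l _ => ?_
  by_cases h : l = i
  · subst h
    by_cases h2 : l < j <;> simp [h2, pow_succ]
  · simp [h]

def opx (j : Fin N) : ((Fin N → ℕ) → k) →ₗ[k] ((Fin N → ℕ) → k) where
  toFun F a := cc k N q j a * F (a + Pi.single j 1)
  map_add' F G := by ext a; simp [mul_add]
  map_smul' c F := by ext a; simp; ring

lemma opx_rel (hq0 : ∀ i j, q i j ≠ 0) (hq1 : ∀ i, q i i = 1)
    (hqinv : ∀ i j, q j i = (q i j)⁻¹) (i j : Fin N) :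
    opx k N q i * opx k N q j = q i j • (opx k N q j * opx k N q i) := by
  ext F a
  have hc : a + Pi.single i 1 + Pi.single j 1 = a + Pi.single j 1 + Pi.single i 1 := by
    rw [add_right_comm]
  simp only [opx, Module.End.mul_apply, LinearMap.coe_mk, AddHom.coe_mk, LinearMap.smul_apply,
    Pi.smul_apply, smul_eq_mul, cc_add, hc]
  rcases lt_trichotomy i j with h | h | h
  · simp [h, not_lt_of_gt h]; ring
  · subst h; simp [hq1]
  · simp only [h, not_lt_of_gt h, if_true, if_false, hqinv i j]
    field_simp [hq0 i j]

lemma xprod_ne_zero (hq0 : ∀ i j, q i j ≠ 0) (hq1 : ∀ i, q i i = 1)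
    (hqinv : ∀ i j, q j i = (q i j)⁻¹) (m : ℕ) (j : Fin m → Fin N) :
    xprod k N q m j ≠ 0 := by
  let ρ : QSA k N q →ₐ[k] Module.End k ((Fin N → ℕ) → k) :=
    RingQuot.liftAlgHom k ⟨FreeAlgebra.lift k (opx k N q), by
      rintro _ _ ⟨a, b⟩
      simpa using opx_rel k N q hq0 hq1 hqinv a b⟩
  have hX : ∀ i, ρ (X k N q i) = opx k N q i := by
    intro i; simp [ρ, X]
  have hcc : ∀ i a, cc k N q i a ≠ 0 := by
    intro i a
    refine Finset.prod_ne_zero_iff.2 fun l _ => ?_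
    split_ifs
    · exact pow_ne_zero _ (hq0 _ _)
    · exact one_ne_zero
  have key : ∀ L : List (Fin N), ∀ a, (ρ (L.map (X k N q)).prod) (fun _ => 1) a ≠ 0 := by
    intro L
    induction L with
    | nil => intro a; simp
    | cons i L ih =>
      intro a
      rw [List.map_cons, List.prod_cons, map_mul, hX, Module.End.mul_apply]
      exact mul_ne_zero (hcc _ _) (ih _)
  intro h
  have h2 := key (List.ofFn j) 0
  have h3 : xprod k N q m j = ((List.ofFn j).map (X k N q)).prod := by
    simp [xprod, List.map_ofFn, Function.comp_def]
  rw [← h3, h] at h2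
  simp at h2

/-- Contraction of all but the last tensor factor. -/
def ctr : (n : ℕ) → (Fin n → Fin N) → (TP k N q n →ₗ[k] QSA k N q)
  | 0, _ => LinearMap.id
  | n + 1, j =>
    show QSA k N q ⊗[k] TP k N q n →ₗ[k] QSA k N q from
      TensorProduct.lift ((LinearMap.lsmul k (TP k N q n →ₗ[k] QSA k N q)).flip
        (ctr n (fun t => j t.succ)) ∘ₗ fFun k N q (j 0))

lemma ctr_succ (n : ℕ) (j : Fin (n + 1) → Fin N) (a : QSA k N q) (t : TP k N q n) :
    ctr k N q (n + 1) j (show QSA k N q ⊗[k] TP k N q n from a ⊗ₜ[k] t) =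
      fFun k N q (j 0) a • ctr k N q n (fun t => j t.succ) t := by
  rfl

lemma rAct_succ (n : ℕ) (b : QSA k N q) (a : QSA k N q) (t : TP k N q n) :
    rAct k N q (n + 1) b (show QSA k N q ⊗[k] TP k N q n from a ⊗ₜ[k] t) =
      (show QSA k N q ⊗[k] TP k N q n from a ⊗ₜ[k] rAct k N q n b t) := by
  rfl

lemma ctr_tp (n : ℕ) (j : Fin n → Fin N) (b : QSA k N q) (v : Fin n → QSA k N q) :
    ctr k N q n j (rAct k N q n b (tp k N q n (Fin.snoc (α := fun _ => QSA k N q) v 1))) =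
      (∏ t, fFun k N q (j t) (v t)) • b := by
  induction n with
  | zero =>
    show ((Fin.snoc (α := fun _ => QSA k N q) v 1 : Fin 1 → QSA k N q) 0) * b = _
    simp [Fin.snoc]
  | succ n ih =>
    have h : (fun t : Fin (n + 1) => (Fin.snoc (α := fun _ => QSA k N q) v 1 :
        Fin (n + 2) → QSA k N q) t.succ) =
        Fin.snoc (α := fun _ => QSA k N q) (fun t : Fin n => v t.succ) 1 := by
      ext t
      refine Fin.lastCases ?_ (fun t => ?_) t
      · rw [Fin.snoc_last, Fin.succ_last, Fin.snoc_last]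
      · rw [Fin.snoc_castSucc, Fin.succ_castSucc, Fin.snoc_castSucc]
    have h0 : (Fin.snoc (α := fun _ => QSA k N q) v 1 : Fin (n + 2) → QSA k N q) 0 = v 0 :=
      Fin.snoc_castSucc (α := fun _ => QSA k N q) 1 v 0
    have h1 : tp k N q (n + 1) (Fin.snoc (α := fun _ => QSA k N q) v 1) =
      (show QSA k N q ⊗[k] TP k N q n from v 0 ⊗ₜ[k]
        tp k N q n (Fin.snoc (α := fun _ => QSA k N q) (fun t : Fin n => v t.succ) 1)) := by
      rw [← h, ← h0]; rfl
    rw [h1, rAct_succ, ctr_succ, ih, Fin.prod_univ_succ, smul_smul]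

/-- Contraction of all inner tensor factors. -/
def dctr (n : ℕ) (j : Fin n → Fin N) : TP k N q (n + 1) →ₗ[k] QSAe k N q :=
  show QSA k N q ⊗[k] TP k N q n →ₗ[k] QSAe k N q from
    LinearMap.lTensor (QSA k N q)
      ((MulOpposite.opLinearEquiv k).toLinearMap ∘ₗ ctr k N q n j)

lemma dctr_outer (n : ℕ) (j : Fin n → Fin N) (w : QSAe k N q) (v : Fin n → QSA k N q) :
    dctr k N q n j (outerAct k N q (n + 1) w
      (tp k N q (n + 1) (Fin.cons 1 (Fin.snoc v 1)))) =
      (∏ t, fFun k N q (j t) (v t)) • w := by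
  induction w using TensorProduct.induction_on with
  | zero => simp
  | add x y hx hy => rw [map_add, LinearMap.add_apply, map_add, hx, hy, smul_add]
  | tmul a b =>
    have : dctr k N q n j (outerAct k N q (n + 1) (a ⊗ₜ b)
      (tp k N q (n + 1) (Fin.cons 1 (Fin.snoc v 1)))) =
      (a * 1) ⊗ₜ[k] MulOpposite.op (ctr k N q n j (rAct k N q n b.unop (tp k N q n
        (Fin.snoc (α := fun _ => QSA k N q) v 1)))) := rfl
    rw [this, ctr_tp, mul_one, MulOpposite.op_smul, MulOpposite.op_unop, TensorProduct.tmul_smul]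

lemma jfun_eq (m : ℕ) (S S' : {S : Finset (Fin N) // S.card = m}) (π : Equiv.Perm (Fin m))
    (h : ∀ t, jfun N m S t = jfun N m S' (π t)) : S = S' ∧ π = 1 := by
  have hr : ∀ T : {S : Finset (Fin N) // S.card = m}, Set.range (jfun N m T) = T.1 := by
    intro T
    have := Finset.range_orderEmbOfFin T.1 T.2
    exact this
  have hS : S = S' := by
    apply Subtype.ext
    apply Finset.coe_injective
    rw [← hr, ← hr]
    have : jfun N m S = jfun N m S' ∘ π := funext h
    rw [this, Set.range_comp, π.surjective.range_eq, Set.image_univ]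
  refine ⟨hS, ?_⟩
  subst hS
  ext t
  have hi : Function.Injective (jfun N m S) := (S.1.orderEmbOfFin S.2).injective
  simpa using congrArg Fin.val (hi (h t)).symm

lemma dctr_phiElt (Qs : (m : ℕ) → (Fin m → Fin N) → Equiv.Perm (Fin m) → k) (m : ℕ)
    (S S' : {S : Finset (Fin N) // S.card = m}) (w : QSAe k N q) :
    dctr k N q m (jfun N m S) (outerAct k N q (m + 1) w (phiElt k N q Qs m S')) =
      if S = S' then Qs m (jfun N m S) 1 • w else 0 := by
  classical
  rw [phiElt, map_sum, map_sum]
  simp_rw [map_smul, dctr_outer, fFun_X]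
  rw [Finset.sum_eq_single 1]
  · split_ifs with h
    · subst h; simp
    · obtain ⟨t, ht⟩ : ∃ t, jfun N m S t ≠ jfun N m S' ((1 : Equiv.Perm (Fin m)) t) := by
        by_contra hc
        push Not at hc
        exact h (jfun_eq N m S S' 1 hc).1
      rw [Finset.prod_eq_zero (Finset.mem_univ t) (if_neg ht), zero_smul, smul_zero]
  · intro π _ hπ
    obtain ⟨t, ht⟩ : ∃ t, jfun N m S t ≠ jfun N m S' (π t) := by
      by_contra hc
      push Not at hc
      exact hπ (jfun_eq N m S S' π hc).2
    rw [Finset.prod_eq_zero (Finset.mem_univ t) (if_neg ht), zero_smul, smul_zero]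
  · simp

end Aux

/-- The map `φ_m : A^e ⊗ ∧^m(V) → A^{⊗(m+2)}` is injective for every `m ≥ 1`. -/
theorem stmt6 (k : Type) [Field k] [CharZero k] (N : ℕ) (hN : 0 < N)
    (q : Fin N → Fin N → k) (hq0 : ∀ i j, q i j ≠ 0) (hq1 : ∀ i, q i i = 1)
    (hqinv : ∀ i j, q j i = (q i j)⁻¹)
    (Qs : (m : ℕ) → (Fin m → Fin N) → Equiv.Perm (Fin m) → k)
    -- `Qs m j π` is the scalar `q_π^{j_1,…,j_m}`, characterised by the equation
    -- `q_π^{j_1,…,j_m} • x_{j_{π(1)}} ⋯ x_{j_{π(m)}} = x_{j_1} ⋯ x_{j_m}` in `S_q(V)`: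
    (hQs : ∀ (m : ℕ) (j : Fin m → Fin N), Function.Injective j →
      ∀ π : Equiv.Perm (Fin m),
        Qs m j π • xprod k N q m (fun t => j (π t)) = xprod k N q m j)
    (m : ℕ) (hm : 1 ≤ m) :
    Function.Injective (phi k N q Qs m) := by
  classical
  have hQ : ∀ S, Qs m (jfun N m S) 1 ≠ 0 := by
    intro S h0
    have h := hQs m (jfun N m S) (S.1.orderEmbOfFin S.2).injective 1
    rw [h0, zero_smul] at h
    exact xprod_ne_zero k N q hq0 hq1 hqinv m _ h.symm
  have h : ∀ w S, dctr k N q m (jfun N m S) (phi k N q Qs m w) =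
      Qs m (jfun N m S) 1 • w S := by
    intro w S
    rw [phi, Finsupp.lsum_apply, Finsupp.sum, map_sum]
    simp only [LinearMap.flip_apply, dctr_phiElt]
    rw [Finset.sum_ite_eq]
    split_ifs with hs
    · rfl
    · rw [Finsupp.notMem_support_iff.1 hs, smul_zero]
  intro w w' hw
  ext1 S
  have h1 := h w S
  rw [hw, h w' S] at h1
  have h2 := congrArg (fun z => (Qs m (jfun N m S) 1)⁻¹ • z) h1
  simpa only [inv_smul_smul₀ (hQ S)] using h2.symm
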